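/- Let A be a complex unital Banach algebra. Fix p ≥ 2, integers x_1 > x_2 > ⋯ > x_p ≥ 1, elements a_z ∈ A for 1 ≤ z ≤ x_1 − 1, and elements b_1, …, b_{p-1} ∈ A. For integers x > y ≥ 1 set U_{x,y} = exp(a_{x-1}) exp(a_{x-2}) ⋯ exp(a_y), which is invertible. Define recursively O_1 = b_1 and O_q = U_{x_{q-1},x_q}⁻¹ · O_{q-1} · U_{x_{q-1},x_q} · b_q for 2 ≤ q ≤ p−1. Then U_{x_{p-1},x_p}⁻¹ · O_{p-1} · U_{x_{p-1},x_p} = ∑_{n=0}^∞ ∑_{n_1+⋯+n_{p-1}=n} ∑_{z} Υ(z_1,…,z_n) · K(z), where: the composition sum is over all (n_1,…,n_{p-1}) of nonnegative integers summing to n; the inner sum is over z_1,…,z_{n_1} ∈ {x_2,…,x_1−1}, z_{n_1+1},…,z_{n_1+n_2} ∈ {x_3,…,x_2−1}, …, z_{n_1+⋯+n_{p-2}+1},…,z_n ∈ {x_p,…,x_{p-1}−1}; and K(z) is built by starting from b_1, taking iterated commutators with a_{z_1},…,a_{z_{n_1}}, multiplying the result on the right by b_2, taking iterated commutators with a_{z_{n_1+1}},…,a_{z_{n_1+n_2}},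 multiplying on the right by b_3, and so on, finally (after right-multiplying by b_{p-1}) taking iterated commutators with the a's of the last segment a_{z_{n_1+⋯+n_{p-2}+1}},…,a_{z_n}. Each inner sum is finite and the outer series over n converges absolutely in A. -/

import Mathlib

open scoped BigOperators

/-- The `Υ` function on a finite sequence of naturals: `0` unless the sequence is
nonincreasing, and `1 / ∏_v m_v!` otherwise, where `m_v` is the number of entries
equal to `v`. -/
noncomputable def Upsilon {n : ℕ} (z : Fin n → ℕ) : ℚ :=
  if ∀ i j : Fin n, i ≤ j → z j ≤ z i then
    ((∏ v ∈ Finset.univ.image z,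
        (Finset.univ.filter fun i => z i = v).card.factorial : ℕ) : ℚ)⁻¹
  else 0

/-- The iterated (nested) commutator of `a` with the entries of the list `l`. -/
def nestComm {A : Type*} [Ring A] (a : A) (l : List A) : A :=
  l.foldl (fun x h => x * h - h * x) a

/-- `Ufwd a x y = exp(a_{x-1}) exp(a_{x-2}) ⋯ exp(a_y)`. -/
noncomputable def Ufwd {A : Type*} [NormedRing A] [NormedAlgebra ℂ A]
    (a : ℕ → A) (x y : ℕ) : A :=
  (List.ofFn fun i : Fin (x - y) => NormedSpace.exp (a (x - 1 - (i : ℕ)))).prod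

/-- `Ubwd a x y = exp(-a_y) exp(-a_{y+1}) ⋯ exp(-a_{x-1})`, the inverse of `Ufwd a x y`. -/
noncomputable def Ubwd {A : Type*} [NormedRing A] [NormedAlgebra ℂ A]
    (a : ℕ → A) (x y : ℕ) : A :=
  (List.ofFn fun i : Fin (x - y) => NormedSpace.exp (-a (y + (i : ℕ)))).prod

/-- Partial sums of a composition `nv : Fin k → ℕ`: `psum nv j = nv 0 + ⋯ + nv (j-1)`. -/
def psum {k : ℕ} (nv : Fin k → ℕ) (j : ℕ) : ℕ :=
  ∑ t ∈ Finset.range j, if h : t < k then nv ⟨t, h⟩ else 0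

/-- The (0-indexed) segment of the composition `nv` containing position `i`:
the number of `j < k` with `psum nv (j+1) ≤ i`. -/
def segIdx {k : ℕ} (nv : Fin k → ℕ) (i : ℕ) : ℕ :=
  ((Finset.range k).filter fun j => psum nv (j + 1) ≤ i).card

/-- The nested structure `K`: starting from `b 1`, take iterated commutators with
the `w`'s of the first segment, multiply on the right by `b 2`, take iterated
commutators with the `w`'s of the second segment, and so on.  `Kfam b w ps j` is the
result after `j` segments, the segments being delimited by the partial sums `ps`. -/
def Kfam {A : Type*} [Ring A] (b : ℕ → A) (w : ℕ → A) (ps : ℕ → ℕ) : ℕ → A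
  | 0 => b 1
  | j + 1 =>
      nestComm (Kfam b w ps j * if j = 0 then 1 else b (j + 1))
        ((List.range (ps (j + 1) - ps j)).map fun t => w (ps j + t))

/-- The recursively defined operators `O_q`: `O_1 = b 1` and
`O_q = U_{x_{q-1},x_q}⁻¹ · O_{q-1} · U_{x_{q-1},x_q} · b_q`.  (`O 0` is junk.) -/
noncomputable def Ofam {A : Type*} [NormedRing A] [NormedAlgebra ℂ A]
    (a b : ℕ → A) (x : ℕ → ℕ) : ℕ → A
  | 0 => 1
  | 1 => b 1
  | q + 2 =>
      Ubwd a (x (q + 1)) (x (q + 2)) * Ofam a b x (q + 1) *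
        Ufwd a (x (q + 1)) (x (q + 2)) * b (q + 2)

section Exponential

theorem exp_add_of_commute_complex {A : Type*} [NormedRing A] [NormedAlgebra ℂ A]
    [CompleteSpace A] {u v : A} (h : Commute u v) :
    NormedSpace.exp (u + v) = NormedSpace.exp u * NormedSpace.exp v := by
  let _ : NormedAlgebra ℚ A := NormedAlgebra.restrictScalars ℚ ℂ A
  exact NormedSpace.exp_add_of_commute h

theorem exp_neg_mul_exp {A : Type*} [NormedRing A] [NormedAlgebra ℂ A] [CompleteSpace A] (u : A) :
    NormedSpace.exp (-u) * NormedSpace.exp u = 1 := by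
  rw [← exp_add_of_commute_complex (Commute.refl u).neg_left, neg_add_cancel,
    NormedSpace.exp_zero]

theorem exp_mul_exp_neg {A : Type*} [NormedRing A] [NormedAlgebra ℂ A] [CompleteSpace A] (u : A) :
    NormedSpace.exp u * NormedSpace.exp (-u) = 1 := by
  simpa using exp_neg_mul_exp (-u)

theorem hasSum_exp_complex {A : Type*} [NormedRing A] [NormedAlgebra ℂ A] [CompleteSpace A]
    (u : A) : HasSum (fun n : ℕ => ((n.factorial : ℂ)⁻¹) • u ^ n) (NormedSpace.exp u) :=
  NormedSpace.exp_series_hasSum_exp' u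

theorem ofFn_eq_map_range {α : Type*} (n : ℕ) (f : ℕ → α) :
    List.ofFn (fun i : Fin n => f i) = (List.range n).map f := by
  apply List.ext_getElem <;> simp

theorem Ubwd_self {A : Type*} [NormedRing A] [NormedAlgebra ℂ A] (a : ℕ → A) (y : ℕ) :
    Ubwd a y y = 1 := by
  simp [Ubwd]

theorem Ufwd_self {A : Type*} [NormedRing A] [NormedAlgebra ℂ A] (a : ℕ → A) (y : ℕ) :
    Ufwd a y y = 1 := by
  simp [Ufwd]

theorem Ubwd_of_lt {A : Type*} [NormedRing A] [NormedAlgebra ℂ A] (a : ℕ → A) {x y : ℕ}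
    (h : y < x) : Ubwd a x y = NormedSpace.exp (-a y) * Ubwd a x (y + 1) := by
  obtain ⟨k, rfl⟩ := Nat.exists_eq_add_of_lt h
  have h₁ : y + k + 1 - y = k + 1 := by omega
  have h₂ : y + k + 1 - (y + 1) = k := by omega
  unfold Ubwd
  rw [ofFn_eq_map_range (y + k + 1 - y) fun i => NormedSpace.exp (-a (y + i)),
    ofFn_eq_map_range (y + k + 1 - (y + 1)) fun i => NormedSpace.exp (-a (y + 1 + i)), h₁, h₂,
    List.range_succ_eq_map]
  simp [Function.comp_def, Nat.add_assoc, Nat.add_comm 1]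

theorem Ufwd_of_lt {A : Type*} [NormedRing A] [NormedAlgebra ℂ A] (a : ℕ → A) {x y : ℕ}
    (h : y < x) : Ufwd a x y = Ufwd a x (y + 1) * NormedSpace.exp (a y) := by
  obtain ⟨k, rfl⟩ := Nat.exists_eq_add_of_lt h
  have h₁ : y + k + 1 - y = k + 1 := by omega
  have h₂ : y + k + 1 - (y + 1) = k := by omega
  unfold Ufwd
  rw [ofFn_eq_map_range (y + k + 1 - y) fun i => NormedSpace.exp (a (y + k + 1 - 1 - i)),
    ofFn_eq_map_range (y + k + 1 - (y + 1)) fun i => NormedSpace.exp (a (y + k + 1 - 1 - i)),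
    h₁, h₂, List.range_succ]
  simp

theorem Ubwd_mul_Ufwd {A : Type*} [NormedRing A] [NormedAlgebra ℂ A] [CompleteSpace A]
    (a : ℕ → A) {x y : ℕ} (h : y ≤ x) :
    Ubwd a x y * Ufwd a x y = 1 ∧ Ufwd a x y * Ubwd a x y = 1 := by
  induction h using Nat.decreasingInduction with
  | self => simp [Ubwd_self, Ufwd_self]
  | of_succ y hy ih =>
    rw [Ubwd_of_lt a hy, Ufwd_of_lt a hy]
    constructor
    · rw [mul_assoc, ← mul_assoc (Ubwd a x (y + 1)), ih.1, one_mul, exp_neg_mul_exp]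
    · rw [mul_assoc, ← mul_assoc (NormedSpace.exp (a y)), exp_mul_exp_neg, one_mul, ih.2]

/-- The operator `c ↦ [c, u]` on a normed algebra. -/
noncomputable def commOp {A : Type*} [NormedRing A] [NormedAlgebra ℂ A] (u : A) : A →L[ℂ] A :=
  (ContinuousLinearMap.mul ℂ A).flip u - ContinuousLinearMap.mul ℂ A u

theorem commOp_apply {A : Type*} [NormedRing A] [NormedAlgebra ℂ A] (u c : A) :
    commOp u c = c * u - u * c := by
  simp [commOp]

theorem exp_mulLeft_apply {A : Type*} [NormedRing A] [NormedAlgebra ℂ A] [CompleteSpace A]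
    (u c : A) :
    NormedSpace.exp (ContinuousLinearMap.mul ℂ A u) c = NormedSpace.exp u * c := by
  have hpow : ∀ n : ℕ, (ContinuousLinearMap.mul ℂ A u ^ n) c = u ^ n * c := by
    intro n
    induction n with
    | zero => simp
    | succ n ih => simp [pow_succ', ih, mul_assoc]
  have h₁ := (ContinuousLinearMap.apply ℂ A c).hasSum
    (hasSum_exp_complex (ContinuousLinearMap.mul ℂ A u))
  have h₂ := (hasSum_exp_complex u).mul_right c
  refine h₁.unique ?_
  simpa [hpow] using h₂

theorem exp_mulRight_apply {A : Type*} [NormedRing A] [NormedAlgebra ℂ A] [CompleteSpace A]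
    (u c : A) :
    NormedSpace.exp ((ContinuousLinearMap.mul ℂ A).flip u) c = c * NormedSpace.exp u := by
  have hpow : ∀ n : ℕ, ((ContinuousLinearMap.mul ℂ A).flip u ^ n) c = c * u ^ n := by
    intro n
    induction n with
    | zero => simp
    | succ n ih => rw [pow_succ', pow_succ]; simp [ih, mul_assoc]
  have h₁ := (ContinuousLinearMap.apply ℂ A c).hasSum
    (hasSum_exp_complex ((ContinuousLinearMap.mul ℂ A).flip u))
  have h₂ := (hasSum_exp_complex u).mul_left c
  refine h₁.unique ?_
  simpa [hpow] using h₂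

theorem exp_commOp_apply {A : Type*} [NormedRing A] [NormedAlgebra ℂ A] [CompleteSpace A]
    (u c : A) :
    NormedSpace.exp (commOp u) c = NormedSpace.exp (-u) * c * NormedSpace.exp u := by
  have hcomm : Commute ((ContinuousLinearMap.mul ℂ A).flip u)
      (ContinuousLinearMap.mul ℂ A (-u)) := by
    ext c
    simp [mul_assoc]
  have h : commOp u = (ContinuousLinearMap.mul ℂ A).flip u + ContinuousLinearMap.mul ℂ A (-u) := by
    rw [map_neg, ← sub_eq_add_neg, commOp]
  rw [h, exp_add_of_commute_complex hcomm, mul_apply_eq_comp,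
    exp_mulLeft_apply, exp_mulRight_apply]

end Exponential

section CauchyProduct

theorem hasSum_antidiagonal_mul {R : Type*} [NormedRing R] [CompleteSpace R] {f g : ℕ → R}
    {s t : R} (hf : Summable fun n => ‖f n‖) (hfs : HasSum f s)
    (hg : Summable fun n => ‖g n‖) (hgt : HasSum g t) :
    HasSum (fun n => ∑ kl ∈ Finset.HasAntidiagonal.antidiagonal n, f kl.1 * g kl.2) (s * t) := by
  rw [← hfs.tsum_eq, ← hgt.tsum_eq, tsum_mul_tsum_eq_tsum_sum_antidiagonal_of_summable_norm hf hg]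
  exact (summable_norm_sum_mul_antidiagonal_of_summable_norm hf hg).of_norm.hasSum

theorem cauchyProduct_apply {A : Type*} [NormedRing A] [NormedAlgebra ℂ A] [CompleteSpace A]
    {f : ℕ → A} {T : ℕ → A →L[ℂ] A} {s : A} {S : A →L[ℂ] A}
    (hf : Summable fun n => ‖f n‖) (hfs : HasSum f s)
    (hT : Summable fun n => ‖T n‖) (hTS : HasSum T S) :
    (Summable fun n => ‖∑ kl ∈ Finset.HasAntidiagonal.antidiagonal n, T kl.2 (f kl.1)‖) ∧
      HasSum (fun n => ∑ kl ∈ Finset.HasAntidiagonal.antidiagonal n, T kl.2 (f kl.1)) (S s) := by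
  have hL : Summable fun n => ‖ContinuousLinearMap.mul ℂ A (f n)‖ :=
    hf.of_nonneg_of_le (fun _ => norm_nonneg _)
      fun _ => ContinuousLinearMap.opNorm_mul_apply_le ℂ A _
  have hLs := (ContinuousLinearMap.mul ℂ A).hasSum hfs
  have key : ∀ n, (ContinuousLinearMap.apply ℂ A (1 : A))
      (∑ kl ∈ Finset.HasAntidiagonal.antidiagonal n, T kl.1 * ContinuousLinearMap.mul ℂ A (f kl.2)) =
        ∑ kl ∈ Finset.HasAntidiagonal.antidiagonal n, T kl.2 (f kl.1) := by
    intro n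
    rw [← Finset.Nat.sum_antidiagonal_swap]
    simp
  constructor
  · have h := summable_norm_sum_mul_antidiagonal_of_summable_norm hT hL
    refine (h.mul_left ‖ContinuousLinearMap.apply ℂ A (1 : A)‖).of_nonneg_of_le
      (fun _ => norm_nonneg _) fun n => ?_
    rw [← key]
    exact ContinuousLinearMap.le_opNorm _ _
  · have h := (ContinuousLinearMap.apply ℂ A (1 : A)).hasSum
      (hasSum_antidiagonal_mul hT hTS hL hLs)
    simpa [key, Function.comp_def] using h

end CauchyProduct

section Tuples

theorem sum_piFinset_append {M : Type*} [AddCommMonoid M] {i k : ℕ}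
    (s : Fin (i + k) → Finset ℕ) (f : (Fin (i + k) → ℕ) → M) :
    ∑ z ∈ Fintype.piFinset s, f z =
      ∑ z₁ ∈ Fintype.piFinset fun j : Fin i => s (Fin.castAdd k j),
        ∑ z₂ ∈ Fintype.piFinset fun j : Fin k => s (Fin.natAdd i j), f (Fin.append z₁ z₂) := by
  rw [← Finset.sum_product']
  refine Finset.sum_bij' (fun z _ => (fun j => z (Fin.castAdd k j), fun j => z (Fin.natAdd i j)))
    (fun q _ => Fin.append q.1 q.2) ?_ ?_ ?_ ?_ ?_
  · intro z hz
    rw [Fintype.mem_piFinset] at hz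
    simp only [Finset.mem_product, Fintype.mem_piFinset]
    exact ⟨fun j => hz _, fun j => hz _⟩
  · intro q hq
    simp only [Finset.mem_product, Fintype.mem_piFinset] at hq
    rw [Fintype.mem_piFinset]
    intro j
    refine Fin.addCases (fun j => ?_) (fun j => ?_) j
    · simpa using hq.1 j
    · simpa using hq.2 j
  · intro z _
    exact Fin.append_castAdd_natAdd
  · intro q _
    simp
  · intro z _
    exact congrArg f Fin.append_castAdd_natAdd.symm

theorem Upsilon_eq_zero {n : ℕ} {z : Fin n → ℕ} (h : ¬ Antitone z) : Upsilon z = 0 := by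
  rw [Upsilon, if_neg]
  exact fun h' => h fun i j hij => h' i j hij

theorem Upsilon_of_antitone {n : ℕ} {z : Fin n → ℕ} (h : Antitone z) :
    Upsilon z = ((∏ v ∈ Finset.univ.image z,
        (Finset.univ.filter fun i => z i = v).card.factorial : ℕ) : ℚ)⁻¹ := by
  rw [Upsilon, if_pos]
  exact fun i j hij => h hij

theorem Upsilon_fin_zero (z : Fin 0 → ℕ) : Upsilon z = 1 := by
  rw [Upsilon_of_antitone (fun i => i.elim0)]
  simp

theorem Upsilon_const (k v : ℕ) : Upsilon (fun _ : Fin k => v) = (k.factorial : ℚ)⁻¹ := by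
  rw [Upsilon_of_antitone antitone_const]
  rcases k with _ | k
  · simp
  · have : (Finset.univ.image fun _ : Fin (k + 1) => v) = {v} :=
      Finset.image_const Finset.univ_nonempty v
    simp [this]

theorem antitone_append_iff {i k : ℕ} {z₁ : Fin i → ℕ} {z₂ : Fin k → ℕ}
    (h : ∀ j l, z₂ l < z₁ j) :
    Antitone (Fin.append z₁ z₂) ↔ Antitone z₁ ∧ Antitone z₂ := by
  constructor
  · intro ha
    constructor
    · intro j l hjl
      simpa using ha (show Fin.castAdd k j ≤ Fin.castAdd k l from hjl)
    · intro j l hjl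
      have : Fin.natAdd i j ≤ Fin.natAdd i l := by simpa using hjl
      simpa using ha this
  · rintro ⟨h₁, h₂⟩ j l
    refine Fin.addCases (fun j => ?_) (fun j => ?_) j <;>
      refine Fin.addCases (fun l => ?_) (fun l => ?_) l <;> intro hjl
    · simpa using h₁ (show j ≤ l from hjl)
    · simpa using (h j l).le
    · rw [Fin.le_def] at hjl
      simp at hjl
      omega
    · have : j ≤ l := by simpa using hjl
      simpa using h₂ this

theorem card_filter_append {i k : ℕ} (z₁ : Fin i → ℕ) (z₂ : Fin k → ℕ) (v : ℕ) :
    (Finset.univ.filter fun j => Fin.append z₁ z₂ j = v).card =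
      (Finset.univ.filter fun j => z₁ j = v).card +
        (Finset.univ.filter fun j => z₂ j = v).card := by
  simp only [Finset.card_filter, Fin.sum_univ_add, Fin.append_left, Fin.append_right]

theorem image_append {i k : ℕ} (z₁ : Fin i → ℕ) (z₂ : Fin k → ℕ) :
    Finset.univ.image (Fin.append z₁ z₂) = Finset.univ.image z₁ ∪ Finset.univ.image z₂ := by
  ext v
  simp only [Finset.mem_image, Finset.mem_union, Finset.mem_univ, true_and]
  constructor
  · rintro ⟨j, rfl⟩
    refine Fin.addCases (fun j => ?_) (fun j => ?_) j
    · exact Or.inl ⟨j, by simp⟩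
    · exact Or.inr ⟨j, by simp⟩
  · rintro (⟨j, rfl⟩ | ⟨j, rfl⟩)
    · exact ⟨Fin.castAdd k j, by simp⟩
    · exact ⟨Fin.natAdd i j, by simp⟩

theorem Upsilon_append {i k : ℕ} {z₁ : Fin i → ℕ} {z₂ : Fin k → ℕ} (h : ∀ j l, z₂ l < z₁ j) :
    Upsilon (Fin.append z₁ z₂) = Upsilon z₁ * Upsilon z₂ := by
  by_cases ha : Antitone z₁ ∧ Antitone z₂
  · rw [Upsilon_of_antitone ((antitone_append_iff h).2 ha), Upsilon_of_antitone ha.1,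
      Upsilon_of_antitone ha.2, ← mul_inv, ← Nat.cast_mul, image_append, Finset.prod_union]
    · congr 3
      · refine Finset.prod_congr rfl fun v hv => ?_
        obtain ⟨j, -, rfl⟩ := Finset.mem_image.1 hv
        rw [card_filter_append, Finset.card_eq_zero.2 (Finset.filter_eq_empty_iff.2
          fun l _ => (h j l).ne), add_zero]
      · refine Finset.prod_congr rfl fun v hv => ?_
        obtain ⟨l, -, rfl⟩ := Finset.mem_image.1 hv
        rw [card_filter_append, Finset.card_eq_zero.2 (Finset.filter_eq_empty_iff.2
          fun j _ => (h j l).ne'), zero_add]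
    · rw [Finset.disjoint_left]
      intro v hv hv'
      obtain ⟨j, -, rfl⟩ := Finset.mem_image.1 hv
      obtain ⟨l, -, hl⟩ := Finset.mem_image.1 hv'
      exact (h j l).ne hl
  · rw [Upsilon_eq_zero (mt (antitone_append_iff h).1 ha)]
    rcases not_and_or.1 ha with ha | ha <;> simp [Upsilon_eq_zero ha]

/-- The entries of an antitone tuple that exceed `y` form an initial segment. -/
theorem exists_cut_of_antitone {n y : ℕ} {z : Fin n → ℕ} (hz : Antitone z) :
    ∃ i ≤ n, ∀ j : Fin n, (j : ℕ) < i ↔ y < z j := by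
  classical
  have hex : ∃ i, ∀ j : Fin n, i ≤ (j : ℕ) → z j ≤ y := ⟨n, fun j hj => by omega⟩
  refine ⟨Nat.find hex, Nat.find_min' hex fun j hj => by omega,
    fun j => ⟨fun hj => ?_, fun hj => ?_⟩⟩
  · have := Nat.find_min hex hj
    push Not at this
    obtain ⟨l, hjl, hl⟩ := this
    exact hl.trans_le (hz hjl)
  · by_contra hcon
    have := Nat.find_spec hex j (not_lt.1 hcon)
    omega

/-- The product `d (z (n-1)) * ⋯ * d (z 0)`. -/
def revWord {E : Type*} [Monoid E] (d : ℕ → E) {n : ℕ} (z : Fin n → ℕ) : E :=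
  (List.ofFn fun i => d (z i)).reverse.prod

theorem revWord_append {E : Type*} [Monoid E] (d : ℕ → E) {i k : ℕ} (z₁ : Fin i → ℕ)
    (z₂ : Fin k → ℕ) : revWord d (Fin.append z₁ z₂) = revWord d z₂ * revWord d z₁ := by
  have : (fun j => d (Fin.append z₁ z₂ j)) = Fin.append (fun j => d (z₁ j)) fun j => d (z₂ j) := by
    ext j
    refine Fin.addCases (fun j => ?_) (fun j => ?_) j <;> simp
  rw [revWord, this, List.ofFn_fin_append, List.reverse_append, List.prod_append]
  rfl

theorem revWord_const {E : Type*} [Monoid E] (d : ℕ → E) (k v : ℕ) :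
    revWord d (fun _ : Fin k => v) = d v ^ k := by
  simp [revWord]

/-- The weighted sum of the reversed words over tuples of length `n` with values in `[y, x)`. -/
noncomputable def wordSum {E : Type*} [Ring E] [Algebra ℂ E] (d : ℕ → E) (x y n : ℕ) : E :=
  ∑ z ∈ Fintype.piFinset (fun _ : Fin n => Finset.Ico y x), ((Upsilon z : ℚ) : ℂ) • revWord d z

theorem wordSum_self {E : Type*} [Ring E] [Algebra ℂ E] (d : ℕ → E) (y n : ℕ) :
    wordSum d y y n = if n = 0 then 1 else 0 := by
  rcases n with _ | n
  · simp [wordSum, Upsilon_fin_zero, revWord]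
  · have : Fintype.piFinset (fun _ : Fin (n + 1) => Finset.Ico y y) = ∅ :=
      Fintype.piFinset_eq_empty.2 ⟨0, Finset.Ico_self y⟩
    rw [wordSum, this, Finset.sum_empty, if_neg n.succ_ne_zero]

theorem wordSum_of_lt {E : Type*} [Ring E] [Algebra ℂ E] (d : ℕ → E) {x y : ℕ} (hxy : y < x)
    (n : ℕ) :
    wordSum d x y n = ∑ kl ∈ Finset.HasAntidiagonal.antidiagonal n,
      ((kl.1.factorial : ℂ)⁻¹ • d y ^ kl.1) * wordSum d x (y + 1) kl.2 := by
  rw [← Finset.Nat.sum_antidiagonal_swap]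
  set F : (Fin n → ℕ) → E := fun z => ((Upsilon z : ℚ) : ℂ) • revWord d z with hF
  set s : ℕ → Fin n → Finset ℕ :=
    fun i j => if (j : ℕ) < i then Finset.Ico (y + 1) x else {y} with hs
  have hterm : ∀ kl ∈ Finset.HasAntidiagonal.antidiagonal n,
      ((kl.2.factorial : ℂ)⁻¹ • d y ^ kl.2) * wordSum d x (y + 1) kl.1 =
        ∑ z ∈ Fintype.piFinset (s kl.1), F z := by
    rintro ⟨i, k⟩ hik
    rw [Finset.HasAntidiagonal.mem_antidiagonal] at hik
    dsimp only at hik ⊢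
    subst hik
    rw [sum_piFinset_append, wordSum, Finset.mul_sum]
    have h₁ : (fun j : Fin i => s i (Fin.castAdd k j)) = fun _ => Finset.Ico (y + 1) x := by
      ext j; simp [hs]
    have h₂ : (fun j : Fin k => s i (Fin.natAdd i j)) = fun _ => {y} := by
      ext j; simp [hs]
    rw [h₁, h₂]
    refine Finset.sum_congr rfl fun z hz => ?_
    rw [Fintype.mem_piFinset] at hz
    have h₃ : Fintype.piFinset (fun _ : Fin k => ({y} : Finset ℕ)) = {fun _ => y} :=
      Fintype.piFinset_singleton fun _ => y
    rw [h₃, Finset.sum_singleton, hF]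
    dsimp only
    rw [Upsilon_append, Upsilon_const, revWord_append, revWord_const]
    · simp [smul_smul, mul_comm]
    · intro j _
      have := hz j
      rw [Finset.mem_Ico] at this
      omega
  have hsub : ∀ i, Fintype.piFinset (s i) ⊆ Fintype.piFinset fun _ : Fin n => Finset.Ico y x := by
    intro i
    refine Fintype.piFinset_subset _ _ fun j => ?_
    intro v hv
    simp only [hs] at hv
    rw [Finset.mem_Ico]
    split_ifs at hv
    · rw [Finset.mem_Ico] at hv; omega
    · rw [Finset.mem_singleton] at hv; omega
  simp only [Prod.fst_swap, Prod.snd_swap]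
  rw [Finset.sum_congr rfl hterm,
    Finset.Nat.sum_antidiagonal_eq_sum_range_succ_mk]
  have hind : ∀ i, ∑ z ∈ Fintype.piFinset (s i), F z =
      ∑ z ∈ Fintype.piFinset fun _ : Fin n => Finset.Ico y x,
        if z ∈ Fintype.piFinset (s i) then F z else 0 := by
    intro i
    rw [Finset.sum_ite_mem, Finset.inter_eq_right.2 (hsub i)]
  simp only [hind]
  rw [Finset.sum_comm, wordSum]
  refine Finset.sum_congr rfl fun z hz => ?_
  by_cases ha : Antitone z
  swap
  · simp [hF, Upsilon_eq_zero ha]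
  rw [Fintype.mem_piFinset] at hz
  obtain ⟨i, hin, hi⟩ := exists_cut_of_antitone (y := y) ha
  have hmem : ∀ l, z ∈ Fintype.piFinset (s l) ↔ ∀ j : Fin n, (j : ℕ) < l ↔ y < z j := by
    intro l
    rw [Fintype.mem_piFinset]
    refine forall_congr' fun j => ?_
    have := Finset.mem_Ico.1 (hz j)
    simp only [hs]
    split_ifs <;> simp <;> omega
  rw [Finset.sum_eq_single i]
  · rw [if_pos ((hmem i).2 hi)]
  · intro l hl hli
    rw [if_neg]
    rw [hmem]
    intro h
    rw [Finset.mem_range] at hl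
    rcases lt_or_gt_of_ne hli with h' | h'
    · have h₁ := h ⟨l, by omega⟩
      have h₂ := hi ⟨l, by omega⟩
      simp only at h₁ h₂
      omega
    · have h₁ := h ⟨i, by omega⟩
      have h₂ := hi ⟨i, by omega⟩
      simp only at h₁ h₂
      omega
  · intro hi'
    rw [Finset.mem_range] at hi'
    omega

theorem hasSum_wordSum_of_lt {E : Type*} [NormedRing E] [NormedAlgebra ℂ E] [CompleteSpace E]
    (d : ℕ → E) {x y : ℕ} (hxy : y < x) {S : E}
    (hsum : Summable fun n => ‖wordSum d x (y + 1) n‖)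
    (hS : HasSum (fun n => wordSum d x (y + 1) n) S) :
    (Summable fun n => ‖wordSum d x y n‖) ∧
      HasSum (fun n => wordSum d x y n) (NormedSpace.exp (d y) * S) := by
  have hexp : Summable fun n : ℕ => ‖((n.factorial : ℂ)⁻¹) • d y ^ n‖ :=
    NormedSpace.norm_expSeries_summable' (d y)
  have h₁ := summable_norm_sum_mul_antidiagonal_of_summable_norm hexp hsum
  have h₂ := hasSum_antidiagonal_mul hexp (hasSum_exp_complex (d y)) hsum hS
  have hrec := wordSum_of_lt d hxy
  generalize wordSum d x y = f at hrec ⊢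
  obtain rfl := funext hrec
  exact ⟨h₁, h₂⟩

theorem hasSum_wordSum_self {E : Type*} [NormedRing E] [NormedAlgebra ℂ E] (d : ℕ → E) (x : ℕ) :
    (Summable fun n => ‖wordSum d x x n‖) ∧ HasSum (fun n => wordSum d x x n) 1 := by
  simp only [wordSum_self]
  refine ⟨summable_of_ne_finset_zero (s := {0}) fun n hn => ?_, hasSum_ite_eq 0 1⟩
  rw [if_neg (by simpa using hn), norm_zero]

/-- Summing the weighted words in the commutators over all lengths conjugates by `Ufwd`. -/
theorem hasSum_wordSum {A : Type*} [NormedRing A] [NormedAlgebra ℂ A] [CompleteSpace A]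
    (a : ℕ → A) {x y : ℕ} (h : y ≤ x) :
    ∃ S : A →L[ℂ] A, (∀ c, S c = Ubwd a x y * c * Ufwd a x y) ∧
      (Summable fun n => ‖wordSum (fun v => commOp (a v)) x y n‖) ∧
        HasSum (fun n => wordSum (fun v => commOp (a v)) x y n) S := by
  induction h using Nat.decreasingInduction with
  | self =>
    exact ⟨1, by simp [Ubwd_self, Ufwd_self], hasSum_wordSum_self _ _⟩
  | of_succ y hy ih =>
    obtain ⟨S, hSc, hsum, hS⟩ := ih
    refine ⟨NormedSpace.exp (commOp (a y)) * S, fun c => ?_,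
      hasSum_wordSum_of_lt (fun v => commOp (a v)) hy hsum hS⟩
    rw [mul_apply_eq_comp, hSc, exp_commOp_apply, Ubwd_of_lt a hy, Ufwd_of_lt a hy]
    simp only [mul_assoc]

end Tuples

section Segments

theorem psum_self {k : ℕ} (nv : Fin k → ℕ) : psum nv k = ∑ i, nv i := by
  rw [psum, Finset.sum_range]
  simp

theorem psum_mono {k : ℕ} (nv : Fin k → ℕ) : Monotone (psum nv) := fun _ _ h =>
  Finset.sum_le_sum_of_subset (Finset.range_mono h)

theorem psum_snoc_of_le {k : ℕ} (nv : Fin k → ℕ) (m : ℕ) {j : ℕ} (h : j ≤ k) :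
    psum (Fin.snoc nv m : Fin (k + 1) → ℕ) j = psum nv j := by
  refine Finset.sum_congr rfl fun t ht => ?_
  rw [Finset.mem_range] at ht
  have htk : t < k := by omega
  rw [dif_pos htk, dif_pos (by omega)]
  exact Fin.snoc_castSucc (α := fun _ => ℕ) m nv ⟨t, htk⟩

theorem psum_snoc_succ {k : ℕ} (nv : Fin k → ℕ) (m : ℕ) :
    psum (Fin.snoc nv m : Fin (k + 1) → ℕ) (k + 1) = ∑ i, nv i + m := by
  rw [psum_self, Fin.sum_univ_castSucc]
  simp

theorem segIdx_snoc {k : ℕ} (nv : Fin k → ℕ) (m : ℕ) {i : ℕ} (h : i < ∑ j, nv j + m) :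
    segIdx (Fin.snoc nv m : Fin (k + 1) → ℕ) i = segIdx nv i := by
  rw [segIdx, Finset.range_add_one, Finset.filter_insert, psum_snoc_succ, if_neg (by omega), segIdx]
  congr 1
  refine Finset.filter_congr fun j hj => ?_
  rw [Finset.mem_range] at hj
  rw [psum_snoc_of_le nv m (by omega)]

theorem segIdx_of_le {k : ℕ} (nv : Fin k → ℕ) {i : ℕ} (h : ∑ j, nv j ≤ i) : segIdx nv i = k := by
  rw [segIdx, Finset.filter_true_of_mem, Finset.card_range]
  intro j hj
  rw [Finset.mem_range] at hj
  exact (psum_mono nv (show j + 1 ≤ k by omega)).trans (psum_self nv ▸ h)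

theorem segIdx_lt {k : ℕ} (nv : Fin k → ℕ) {i : ℕ} (h : i < ∑ j, nv j) : segIdx nv i < k := by
  rcases k with _ | k
  · simp at h
  · rw [segIdx, Finset.range_add_one, Finset.filter_insert, psum_self, if_neg (by omega)]
    exact Nat.lt_succ_of_le ((Finset.card_filter_le _ _).trans_eq (Finset.card_range k))

theorem Kfam_congr {A : Type*} [Ring A] (b : ℕ → A) {w w' : ℕ → A} {ps ps' : ℕ → ℕ}
    (hps' : Monotone ps') {k : ℕ} (hps : ∀ j ≤ k, ps j = ps' j) (hw : ∀ t < ps' k, w t = w' t) :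
    Kfam b w ps k = Kfam b w' ps' k := by
  induction k with
  | zero => rfl
  | succ k ih =>
    have hk : ps' k ≤ ps' (k + 1) := hps' (Nat.le_succ k)
    rw [Kfam, Kfam, ih (fun j hj => hps j (by omega)) fun t ht => hw t (by omega),
      hps k (by omega), hps (k + 1) le_rfl]
    congr 1
    refine List.map_congr_left fun t ht => hw _ ?_
    rw [List.mem_range] at ht
    omega

theorem nestComm_ofFn {A : Type*} [NormedRing A] [NormedAlgebra ℂ A] (a : ℕ → A) (c : A) {m : ℕ}
    (z : Fin m → ℕ) :
    nestComm c (List.ofFn fun i => a (z i)) = revWord (fun v => commOp (a v)) z c := by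
  have h : ∀ (l : List A) (c : A), nestComm c l = (l.map commOp).reverse.prod c := by
    intro l
    induction l with
    | nil => intro c; simp [nestComm]
    | cons u l ih =>
      intro c
      have := ih (c * u - u * c)
      rw [List.map_cons, List.reverse_cons, List.prod_append, List.prod_singleton,
        mul_apply_eq_comp, commOp_apply, ← this]
      rfl
  rw [h, List.map_ofFn]
  rfl

theorem Kfam_append {A : Type*} [NormedRing A] [NormedAlgebra ℂ A] (a b : ℕ → A) {k i m : ℕ}
    (nv : Fin k → ℕ) (hnv : ∑ j, nv j = i) (z₁ : Fin i → ℕ) (z₂ : Fin m → ℕ) :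
    Kfam b (fun t => if h : t < i + m then a (Fin.append z₁ z₂ ⟨t, h⟩) else 1)
        (psum (Fin.snoc nv m : Fin (k + 1) → ℕ)) (k + 1) =
      revWord (fun v => commOp (a v)) z₂
        (Kfam b (fun t => if h : t < i then a (z₁ ⟨t, h⟩) else 1) (psum nv) k *
          if k = 0 then 1 else b (k + 1)) := by
  have hk : psum (Fin.snoc nv m : Fin (k + 1) → ℕ) k = i := by
    rw [psum_snoc_of_le nv m le_rfl, psum_self, hnv]
  rw [← nestComm_ofFn, Kfam, psum_snoc_succ, hk, hnv]
  congr 2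
  · refine Kfam_congr b (psum_mono nv) (fun j hj => psum_snoc_of_le nv m hj) fun t ht => ?_
    rw [psum_self, hnv] at ht
    rw [dif_pos ht, dif_pos (by omega)]
    exact congrArg a (Fin.append_left z₁ z₂ ⟨t, ht⟩)
  · apply List.ext_getElem
    · simp
    · intro t h₁ h₂
      have ht : t < m := by simpa using h₂
      simp only [List.getElem_map, List.getElem_range, List.getElem_ofFn]
      rw [dif_pos (by omega)]
      exact congrArg a (Fin.append_right z₁ z₂ ⟨t, ht⟩)

/-- The compositions of `n` into `k` nonnegative parts. -/
def compositions (k n : ℕ) : Finset (Fin k → ℕ) :=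
  (Fintype.piFinset fun _ : Fin k => Finset.range (n + 1)).filter fun nv => ∑ i, nv i = n

theorem mem_compositions {k n : ℕ} {nv : Fin k → ℕ} :
    nv ∈ compositions k n ↔ ∑ i, nv i = n := by
  rw [compositions, Finset.mem_filter, Fintype.mem_piFinset, and_iff_right_iff_imp]
  rintro rfl i
  rw [Finset.mem_range, Nat.lt_succ_iff]
  exact Finset.single_le_sum (fun _ _ => Nat.zero_le _) (Finset.mem_univ i)

theorem sum_compositions_succ {M : Type*} [AddCommMonoid M] (k n : ℕ)
    (F : (Fin (k + 1) → ℕ) → M) :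
    ∑ nv ∈ compositions (k + 1) n, F nv =
      ∑ kl ∈ Finset.HasAntidiagonal.antidiagonal n, ∑ nv ∈ compositions k kl.1,
        F (Fin.snoc nv kl.2) := by
  rw [Finset.sum_sigma']
  refine Finset.sum_bij'
    (fun nv _ => ⟨(∑ i, Fin.init nv i, nv (Fin.last k)), Fin.init nv⟩)
    (fun q _ => Fin.snoc q.2 q.1.2) ?_ ?_ ?_ ?_ ?_
  · intro nv hnv
    rw [mem_compositions, Fin.sum_univ_castSucc] at hnv
    rw [Finset.mem_sigma, Finset.HasAntidiagonal.mem_antidiagonal, mem_compositions]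
    exact ⟨hnv, rfl⟩
  · rintro ⟨⟨i, m⟩, nv⟩ hq
    rw [Finset.mem_sigma, Finset.HasAntidiagonal.mem_antidiagonal, mem_compositions] at hq
    rw [mem_compositions, Fin.sum_univ_castSucc]
    simpa [hq.2] using hq.1
  · intro nv _
    exact Fin.snoc_init_self nv
  · rintro ⟨⟨i, m⟩, nv⟩ hq
    rw [Finset.mem_sigma, Finset.HasAntidiagonal.mem_antidiagonal, mem_compositions] at hq
    replace hq : ∑ j, nv j = i := hq.2
    subst hq
    simp
  · intro nv _
    exact congrArg F (Fin.snoc_init_self nv).symm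

/-- The degree `n` part of the series obtained after `k` segments. -/
noncomputable def segTerm {A : Type*} [NormedRing A] [NormedAlgebra ℂ A] (a b : ℕ → A)
    (x : ℕ → ℕ) (k n : ℕ) : A :=
  ∑ nv ∈ compositions k n,
    ∑ z ∈ Fintype.piFinset (fun i : Fin n =>
        Finset.Icc (x (segIdx nv (i : ℕ) + 2)) (x (segIdx nv (i : ℕ) + 1) - 1)),
      ((Upsilon z : ℚ) : ℂ) •
        Kfam b (fun t => if h : t < n then a (z ⟨t, h⟩) else 1) (psum nv) k

theorem segTerm_zero {A : Type*} [NormedRing A] [NormedAlgebra ℂ A] (a b : ℕ → A)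
    (x : ℕ → ℕ) (n : ℕ) : segTerm a b x 0 n = if n = 0 then b 1 else 0 := by
  rcases n with _ | n
  · have h : compositions 0 0 = {Fin.elim0} := by
      ext nv
      simp [mem_compositions, eq_iff_true_of_subsingleton]
    simp [segTerm, h, Upsilon_fin_zero, Kfam]
  · have h : compositions 0 (n + 1) = ∅ := by
      ext nv
      simp [mem_compositions]
    simp [segTerm, h]

theorem segTerm_succ {A : Type*} [NormedRing A] [NormedAlgebra ℂ A] (a b : ℕ → A)
    (x : ℕ → ℕ) (k n : ℕ) (hx : ∀ q, 1 ≤ q → q ≤ k → x (q + 1) ≤ x q) (hpos : 1 ≤ x (k + 1)) :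
    segTerm a b x (k + 1) n = ∑ kl ∈ Finset.HasAntidiagonal.antidiagonal n,
      wordSum (fun v => commOp (a v)) (x (k + 1)) (x (k + 2)) kl.2
        (segTerm a b x k kl.1 * if k = 0 then 1 else b (k + 1)) := by
  have hanti : ∀ s, s < k → x (k + 1) ≤ x (s + 2) := by
    intro s hs
    obtain ⟨d, rfl⟩ := Nat.exists_eq_add_of_lt hs
    clear hs hpos
    induction d with
    | zero => rfl
    | succ d ih =>
      exact (hx (s + (d + 1) + 1) (by omega) le_rfl).trans
        (ih fun q h₁ h₂ => hx q h₁ (by omega))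
  rw [segTerm, sum_compositions_succ]
  refine Finset.sum_congr rfl ?_
  rintro ⟨i, m⟩ him
  rw [Finset.HasAntidiagonal.mem_antidiagonal] at him
  dsimp only at him ⊢
  subst him
  rw [segTerm, Finset.sum_mul, map_sum]
  refine Finset.sum_congr rfl fun nv hnv => ?_
  rw [mem_compositions] at hnv
  rw [sum_piFinset_append, Finset.sum_mul, map_sum]
  have h₁ : (fun j : Fin i => Finset.Icc
      (x (segIdx (Fin.snoc nv m : Fin (k + 1) → ℕ) (Fin.castAdd m j : ℕ) + 2))
      (x (segIdx (Fin.snoc nv m : Fin (k + 1) → ℕ) (Fin.castAdd m j : ℕ) + 1) - 1)) =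
      fun j : Fin i => Finset.Icc (x (segIdx nv (j : ℕ) + 2)) (x (segIdx nv (j : ℕ) + 1) - 1) := by
    funext j
    rw [segIdx_snoc nv m (by rw [hnv]; exact (Fin.castAdd m j).isLt), Fin.val_castAdd]
  have h₂ : (fun j : Fin m => Finset.Icc
      (x (segIdx (Fin.snoc nv m : Fin (k + 1) → ℕ) (Fin.natAdd i j : ℕ) + 2))
      (x (segIdx (Fin.snoc nv m : Fin (k + 1) → ℕ) (Fin.natAdd i j : ℕ) + 1) - 1)) =
      fun j : Fin m => Finset.Ico (x (k + 2)) (x (k + 1)) := by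
    funext j
    rw [segIdx_snoc nv m (by rw [hnv]; exact (Fin.natAdd i j).isLt),
      segIdx_of_le nv (by rw [hnv]; simp)]
    ext v
    rw [Finset.mem_Icc, Finset.mem_Ico]
    omega
  rw [h₁, h₂]
  refine Finset.sum_congr rfl fun z₁ hz₁ => ?_
  rw [Fintype.mem_piFinset] at hz₁
  rw [wordSum, sum_apply]
  refine Finset.sum_congr rfl fun z₂ hz₂ => ?_
  rw [Fintype.mem_piFinset] at hz₂
  rw [Kfam_append a b nv hnv, Upsilon_append, smul_mul_assoc, map_smul,
    smul_apply, smul_smul]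
  · push_cast
    rfl
  · intro j l
    have h₃ := Finset.mem_Icc.1 (hz₁ j)
    have h₄ := Finset.mem_Ico.1 (hz₂ l)
    exact h₄.2.trans_le ((hanti _ (segIdx_lt nv (by rw [hnv]; exact j.isLt))).trans h₃.1)

theorem hasSum_segTerm_succ {A : Type*} [NormedRing A] [NormedAlgebra ℂ A] [CompleteSpace A]
    (a b : ℕ → A) (x : ℕ → ℕ) (k : ℕ) (hx : ∀ q, 1 ≤ q → q ≤ k + 1 → x (q + 1) ≤ x q)
    (hpos : 1 ≤ x (k + 1)) {s : A} (hsum : Summable fun n => ‖segTerm a b x k n‖)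
    (hs : HasSum (fun n => segTerm a b x k n) s) :
    (Summable fun n => ‖segTerm a b x (k + 1) n‖) ∧
      HasSum (fun n => segTerm a b x (k + 1) n)
        (Ubwd a (x (k + 1)) (x (k + 2)) * (s * if k = 0 then 1 else b (k + 1)) *
          Ufwd a (x (k + 1)) (x (k + 2))) := by
  have hle : x (k + 2) ≤ x (k + 1) := hx (k + 1) (by omega) le_rfl
  obtain ⟨S, hSc, hT, hTS⟩ := hasSum_wordSum a hle
  have hrec := fun n => segTerm_succ a b x k n (fun q h₁ h₂ => hx q h₁ (by omega)) hpos
  rw [← hSc]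
  generalize (if k = 0 then 1 else b (k + 1) : A) = c at hrec ⊢
  generalize segTerm a b x (k + 1) = g at hrec ⊢
  generalize segTerm a b x k = f at hrec hsum hs
  generalize wordSum (fun v => commOp (a v)) (x (k + 1)) (x (k + 2)) = T at hrec hT hTS
  simp only [hrec]
  have hfc : Summable fun n => ‖f n * c‖ :=
    (hsum.mul_right ‖c‖).of_nonneg_of_le (fun _ => norm_nonneg _) fun _ => norm_mul_le _ _
  have hfs : HasSum (fun n => f n * c) (s * c) := hs.mul_right c
  have h := cauchyProduct_apply (f := fun n => f n * c) (T := T) hfc hfs hT hTS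
  exact h

theorem hasSum_segTerm {A : Type*} [NormedRing A] [NormedAlgebra ℂ A] [CompleteSpace A]
    (a b : ℕ → A) (x : ℕ → ℕ) (k : ℕ) (hx : ∀ q, 1 ≤ q → q ≤ k + 1 → x (q + 1) ≤ x q)
    (hpos : 1 ≤ x (k + 1)) :
    (Summable fun n => ‖segTerm a b x (k + 1) n‖) ∧
      HasSum (fun n => segTerm a b x (k + 1) n)
        (Ubwd a (x (k + 1)) (x (k + 2)) * Ofam a b x (k + 1) *
          Ufwd a (x (k + 1)) (x (k + 2))) := by
  induction k with
  | zero =>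
    have h₀ : (Summable fun n => ‖segTerm a b x 0 n‖) ∧
        HasSum (fun n => segTerm a b x 0 n) (b 1) := by
      simp only [segTerm_zero]
      refine ⟨summable_of_ne_finset_zero (s := {0}) fun n hn => ?_, hasSum_ite_eq 0 (b 1)⟩
      rw [if_neg (by simpa using hn), norm_zero]
    have h := hasSum_segTerm_succ a b x 0 hx hpos h₀.1 h₀.2
    rw [if_pos rfl, mul_one] at h
    exact h
  | succ k ih =>
    obtain ⟨hsum, hs⟩ := ih (fun q h₁ h₂ => hx q h₁ (by omega))
      (hpos.trans (hx (k + 1) (by omega) (by omega)))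
    have h := hasSum_segTerm_succ a b x (k + 1) hx hpos hsum hs
    rw [if_neg k.succ_ne_zero] at h
    exact h

end Segments

/-- The conjugation `U_{x_{p-1},x_p}⁻¹ · O_{p-1} · U_{x_{p-1},x_p}` equals the
absolutely convergent series over `n` of the sum over compositions
`(n₁,…,n_{p-1})` of `n` into nonnegative parts and over tuples `z` whose `j`-th
segment entries range over `{x_{j+1},…,x_j − 1}`, of `Υ(z) • K(z)`.  Moreover each
`U_{x,y}` (for `x > y`) is invertible, with inverse `Ubwd a x y`. -/
theorem conj_Ofam_eq_upsilon_series {A : Type*} [NormedRing A] [NormedAlgebra ℂ A]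
    [CompleteSpace A] (p : ℕ) (hp : 2 ≤ p) (x : ℕ → ℕ)
    (hx : ∀ q : ℕ, 1 ≤ q → q < p → x (q + 1) < x q) (hxp : 1 ≤ x p)
    (a b : ℕ → A) :
    (∀ x' y' : ℕ, y' < x' → Ubwd a x' y' * Ufwd a x' y' = 1 ∧
        Ufwd a x' y' * Ubwd a x' y' = 1) ∧
    Summable (fun n : ℕ =>
      ‖∑ nv ∈ (Fintype.piFinset fun _ : Fin (p - 1) => Finset.range (n + 1)).filter
            (fun nv => ∑ i, nv i = n),
          ∑ z ∈ Fintype.piFinset (fun i : Fin n =>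
              Finset.Icc (x (segIdx nv (i : ℕ) + 2)) (x (segIdx nv (i : ℕ) + 1) - 1)),
            ((Upsilon z : ℚ) : ℂ) •
              Kfam b (fun t => if h : t < n then a (z ⟨t, h⟩) else 1) (psum nv)
                (p - 1)‖) ∧
    HasSum (fun n : ℕ =>
      ∑ nv ∈ (Fintype.piFinset fun _ : Fin (p - 1) => Finset.range (n + 1)).filter
            (fun nv => ∑ i, nv i = n),
        ∑ z ∈ Fintype.piFinset (fun i : Fin n =>
            Finset.Icc (x (segIdx nv (i : ℕ) + 2)) (x (segIdx nv (i : ℕ) + 1) - 1)),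
          ((Upsilon z : ℚ) : ℂ) •
            Kfam b (fun t => if h : t < n then a (z ⟨t, h⟩) else 1) (psum nv) (p - 1))
      (Ubwd a (x (p - 1)) (x p) * Ofam a b x (p - 1) * Ufwd a (x (p - 1)) (x p)) := by
  refine ⟨fun x' y' h => Ubwd_mul_Ufwd a h.le, ?_⟩
  obtain ⟨k, rfl⟩ := Nat.exists_eq_add_of_le' hp
  refine hasSum_segTerm a b x k (fun q h₁ h₂ => (hx q h₁ (by omega)).le) ?_
  exact hxp.trans (hx (k + 1) (by omega) (by omega)).le
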